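/- Let U = [[A_U, B_U],[C_U, D_U]] and V = [[A_V, B_V],[C_V, D_V]] be complex block matrices with blocks of matching sizes. Suppose R(B_V) ⊆ R(A_V) and R(C_Uᴴ) ⊆ R(A_Uᴴ). If (U, V) is a Moore-Penrose inverse absorbing pair, then (A_U, A_V) is also a Moore-Penrose inverse absorbing pair. -/

import Mathlib

open Matrix

/-- `X` is the Moore-Penrose inverse of `A`. -/
def IsMoorePenrose {m n : Type*} [Fintype m] [Fintype n]
    (A : Matrix m n ℂ) (X : Matrix n m ℂ) : Prop :=
  A * X * A = A ∧ X * A * X = X ∧ (A * X)ᴴ = A * X ∧ (X * A)ᴴ = X * A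

/-- The column space (range) of a complex matrix. -/
noncomputable def colSpace {m n : Type*} [Fintype n] (A : Matrix m n ℂ) :
    Submodule ℂ (m → ℂ) :=
  LinearMap.range A.mulVecLin

namespace IsMoorePenrose

variable {m n : Type*} [Fintype m] [Fintype n]

theorem symm {A : Matrix m n ℂ} {X : Matrix n m ℂ} (h : IsMoorePenrose A X) :
    IsMoorePenrose X A :=
  ⟨h.2.1, h.1, h.2.2.2, h.2.2.1⟩

/-- A Hermitian matrix fixing `A` from the left fixes its Moore-Penrose inverse from the right. -/
theorem mul_eq_of_mul_eq {A : Matrix m n ℂ} {X : Matrix n m ℂ} (h : IsMoorePenrose A X)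
    {P : Matrix m m ℂ} (hP : Pᴴ = P) (hA : P * A = A) : X * P = X := by
  have hA' : Aᴴ * P = Aᴴ := by
    simpa only [conjTranspose_mul, hP] using congrArg conjTranspose hA
  have hX : X = X * (Xᴴ * Aᴴ) := by
    rw [← conjTranspose_mul, h.2.2.1, ← Matrix.mul_assoc, h.2.1]
  calc X * P = X * (Xᴴ * (Aᴴ * P)) := by
        conv_lhs => rw [hX]
        simp only [Matrix.mul_assoc]
    _ = X := by rw [hA', ← hX]

/-- A Hermitian matrix fixing the Moore-Penrose inverse of `A` from the right fixes `A` from the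
left. -/
theorem mul_eq_of_inverse_mul_eq {A : Matrix m n ℂ} {X : Matrix n m ℂ} (h : IsMoorePenrose A X)
    {P : Matrix m m ℂ} (hP : Pᴴ = P) (hX : X * P = X) : P * A = A := by
  have hX' : P * Xᴴ = Xᴴ := by
    simpa only [conjTranspose_mul, hP] using congrArg conjTranspose hX
  have hA : A = Xᴴ * Aᴴ * A := by
    rw [← conjTranspose_mul, h.2.2.1, h.1]
  calc P * A = P * Xᴴ * Aᴴ * A := by
        conv_lhs => rw [hA]
        simp only [Matrix.mul_assoc]
    _ = A := by rw [hX', ← hA]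

/-- A pair `(A, B)` is absorbing if and only if the column space of `A` lies in that of `B` and
the row space of `B` lies in that of `A`, expressed by orthogonal projections. -/
theorem absorbing_iff {A B : Matrix m n ℂ} {X Y : Matrix n m ℂ}
    (hA : IsMoorePenrose A X) (hB : IsMoorePenrose B Y) :
    X + Y = X * (A + B) * Y ↔ B * Y * A = A ∧ B * (X * A) = B := by
  have expand : X * (A + B) * Y = X * A * Y + X * (B * Y) := by
    rw [Matrix.mul_add, Matrix.add_mul, Matrix.mul_assoc X B Y]
  rw [expand]
  constructor
  · intro h
    have hX : X * (B * Y) = X := by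
      have h' := congrArg (X * A * ·) h
      have idem : X * A * (X * A * Y) = X * A * Y := by
        rw [← Matrix.mul_assoc, ← Matrix.mul_assoc (X * A) X A, hA.2.1]
      simp only [Matrix.mul_add, idem] at h'
      rw [← Matrix.mul_assoc (X * A) X, hA.2.1, add_comm] at h'
      exact (add_left_cancel h').symm
    have hY : X * A * Y = Y := by
      rw [hX, add_comm] at h
      exact (add_right_cancel h).symm
    exact ⟨hA.mul_eq_of_inverse_mul_eq hB.2.2.1 hX,
      hB.symm.mul_eq_of_mul_eq hA.2.2.2 hY⟩
  · rintro ⟨hBA, hAB⟩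
    rw [hA.mul_eq_of_mul_eq hB.2.2.1 hBA, hB.symm.mul_eq_of_inverse_mul_eq hA.2.2.2 hAB,
      add_comm]

/-- The projection `A * X` fixes every matrix whose columns lie in the column space of `A`. -/
theorem mul_mul_eq_of_colSpace_le {k : Type*} [Fintype k] {A : Matrix m n ℂ}
    {X : Matrix n m ℂ} (h : IsMoorePenrose A X) {B : Matrix m k ℂ}
    (hB : colSpace B ≤ colSpace A) : A * X * B = B := by
  refine Matrix.ext_iff_mulVec.mpr fun v => ?_
  obtain ⟨w, hw⟩ := hB (LinearMap.mem_range_self B.mulVecLin v)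
  simp only [mulVecLin_apply] at hw
  rw [← mulVec_mulVec, ← hw, mulVec_mulVec, h.1]

protected theorem conjTranspose {A : Matrix m n ℂ} {X : Matrix n m ℂ} (h : IsMoorePenrose A X) :
    IsMoorePenrose Aᴴ Xᴴ := by
  obtain ⟨h1, h2, h3, h4⟩ := h
  refine ⟨?_, ?_, ?_, ?_⟩
  · rw [Matrix.mul_assoc, ← conjTranspose_mul, ← conjTranspose_mul, h1]
  · rw [Matrix.mul_assoc, ← conjTranspose_mul, ← conjTranspose_mul, h2]
  · rw [← conjTranspose_mul, h4, h4]
  · rw [← conjTranspose_mul, h3, h3]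

end IsMoorePenrose

theorem inheritance_leading_block_moore_penrose_absorbing {m n p s : ℕ}
    (AU : Matrix (Fin m) (Fin n) ℂ) (BU : Matrix (Fin m) (Fin p) ℂ)
    (CU : Matrix (Fin s) (Fin n) ℂ) (DU : Matrix (Fin s) (Fin p) ℂ)
    (AV : Matrix (Fin m) (Fin n) ℂ) (BV : Matrix (Fin m) (Fin p) ℂ)
    (CV : Matrix (Fin s) (Fin n) ℂ) (DV : Matrix (Fin s) (Fin p) ℂ)
    (AUp AVp : Matrix (Fin n) (Fin m) ℂ)
    (hAU : IsMoorePenrose AU AUp) (hAV : IsMoorePenrose AV AVp)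
    (Up Vp : Matrix (Fin n ⊕ Fin p) (Fin m ⊕ Fin s) ℂ)
    (hU : IsMoorePenrose (Matrix.fromBlocks AU BU CU DU) Up)
    (hV : IsMoorePenrose (Matrix.fromBlocks AV BV CV DV) Vp)
    (h1 : colSpace BV ≤ colSpace AV)
    (h2 : colSpace CUᴴ ≤ colSpace AUᴴ)
    (habs : Up + Vp =
      Up * (Matrix.fromBlocks AU BU CU DU + Matrix.fromBlocks AV BV CV DV) * Vp) :
    AUp + AVp = AUp * (AU + AV) * AVp := by
  obtain ⟨hVU, hUV⟩ := (hU.absorbing_iff hV).1 habs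
  refine (hAU.absorbing_iff hAV).2 ⟨?_, ?_⟩
  · have hBV := hAV.mul_mul_eq_of_colSpace_le h1
    rw [Matrix.mul_assoc] at hVU
    generalize Vp * fromBlocks AU BU CU DU = Z at hVU
    rw [← fromBlocks_toBlocks Z, fromBlocks_multiply] at hVU
    rw [← (fromBlocks_inj.1 hVU).1, Matrix.mul_add, ← Matrix.mul_assoc, ← Matrix.mul_assoc,
      hAV.1, hBV]
  · have hCU : CU * (AUp * AU) = CU := by
      have h := congrArg Matrix.conjTranspose (hAU.conjTranspose.mul_mul_eq_of_colSpace_le h2)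
      simpa only [conjTranspose_mul, conjTranspose_conjTranspose] using h
    rw [← Matrix.mul_assoc] at hUV
    generalize fromBlocks AV BV CV DV * Up = Z at hUV
    rw [← fromBlocks_toBlocks Z, fromBlocks_multiply] at hUV
    rw [← (fromBlocks_inj.1 hUV).1, Matrix.add_mul, Matrix.mul_assoc, Matrix.mul_assoc, hCU,
      ← Matrix.mul_assoc AU, hAU.1]
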